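/- arXiv:2103.04734 — 2 statements merged into one kernel-verified Lean document; each statement's English description precedes it below -/
import Mathlib

section
/- Let G be an admissible transformed solution and let τ₁ > 0. Then for all 0 < τ < τ₁ the weighted norm ‖η G(·,τ)‖(τ) := (∫_{−1/(6τ²)}^{+∞} η² |G(η,τ)|² dη)^{1/2} satisfies ‖η G(·,τ)‖(τ) ≤ ‖η G(·,τ₁)‖(τ₁) + τ₁ · ‖∂_η G(·,τ₁)‖(τ₁); in particular sup_{0<τ<τ₁} ‖η G(·,τ)‖(τ) is finite. -/
open MeasureTheory Filter Set Function

noncomputable section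

/-- Partial derivative in the first variable. -/
def pdX (f : ℝ → ℝ → ℂ) : ℝ → ℝ → ℂ := fun x t => deriv (fun y => f y t) x

/-- Partial derivative in the second variable. -/
def pdT (f : ℝ → ℝ → ℂ) : ℝ → ℝ → ℂ := fun x t => deriv (fun s => f x s) t

/-- L² norm over the half-line (0,∞). -/
def L2h (f : ℝ → ℂ) : ℝ := Real.sqrt (∫ x in Set.Ioi (0:ℝ), ‖f x‖^2)

/-- L² norm over ℝ. -/
def L2R (f : ℝ → ℂ) : ℝ := Real.sqrt (∫ x : ℝ, ‖f x‖^2)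

/-- An admissible transformed solution: infinitely smooth on
Ω̃ ∪ l = {(η,τ) : τ > 0, η ≥ -1/(6τ²)}, satisfying i G_τ - (1/2) G_ηη = 0 in Ω̃,
vanishing on the boundary curve l, with super-algebraic decay as η → +∞
uniformly on compact τ-intervals in (0,∞). -/
structure IsAdmissibleTr (G : ℝ → ℝ → ℂ) : Prop where
  smooth : ContDiffOn ℝ (⊤ : ℕ∞) (Function.uncurry G)
    {p : ℝ × ℝ | 0 < p.2 ∧ -1/(6*p.2^2) ≤ p.1}
  eqn : ∀ η τ : ℝ, 0 < τ → -1/(6*τ^2) < η →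
    Complex.I * pdT G η τ - (1/2) * pdX (pdX G) η τ = 0
  bc : ∀ τ : ℝ, 0 < τ → G (-1/(6*τ^2)) τ = 0
  decay : ∀ (α β γ : ℕ) (δ τ₁ : ℝ), 0 < δ → δ < τ₁ → ∀ ε > 0, ∃ X : ℝ, ∀ η ≥ X,
    ∀ τ ∈ Set.Icc δ τ₁, η ^ α * ‖(pdT^[β] (pdX^[γ] G)) η τ‖ < ε

/-- The L² norm in η over (-1/(6τ²), +∞). -/
def trNorm (G : ℝ → ℝ → ℂ) (τ : ℝ) : ℝ :=
  Real.sqrt (∫ η in Set.Ioi (-1/(6*τ^2)), ‖G η τ‖^2)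

/-- The weighted L² norm ‖η G(·,τ)‖(τ) over (-1/(6τ²), +∞). -/
def trNormW (G : ℝ → ℝ → ℂ) (τ : ℝ) : ℝ :=
  Real.sqrt (∫ η in Set.Ioi (-1/(6*τ^2)), η^2 * ‖G η τ‖^2)

section RapidDecay

variable {E : Type*} [NormedAddCommGroup E]

/-- The closed-open quarter plane `{x ≥ 0, τ > 0}`. -/
def quarter : Set (ℝ × ℝ) := Set.Ici 0 ×ˢ Set.Ioi 0

/-- Continuous functions on the quarter plane decaying faster than any power of `x`,
locally uniformly in `τ`. -/
structure RapidDecay (f : ℝ → ℝ → E) : Prop where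
  cont : ContinuousOn (uncurry f) quarter
  bound : ∀ (k : ℕ) (δ T : ℝ), 0 < δ →
    ∃ C : ℝ, ∀ x, 0 ≤ x → ∀ τ ∈ Set.Icc δ T, (1 + x) ^ k * ‖f x τ‖ ≤ C

namespace RapidDecay

theorem continuousOn_slice {f : ℝ → ℝ → E} (hf : RapidDecay f) {τ : ℝ} (hτ : 0 < τ) :
    ContinuousOn (fun x => f x τ) (Set.Ici 0) :=
  hf.cont.comp (f := fun x : ℝ => (x, τ)) (by fun_prop) fun _ hx => ⟨hx, hτ⟩

theorem add {f g : ℝ → ℝ → E} (hf : RapidDecay f) (hg : RapidDecay g) :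
    RapidDecay (fun x τ => f x τ + g x τ) where
  cont := hf.cont.add hg.cont
  bound k δ T hδ := by
    obtain ⟨C, hC⟩ := hf.bound k δ T hδ
    obtain ⟨D, hD⟩ := hg.bound k δ T hδ
    refine ⟨C + D, fun x hx τ hτ => ?_⟩
    calc (1 + x) ^ k * ‖f x τ + g x τ‖ ≤ (1 + x) ^ k * (‖f x τ‖ + ‖g x τ‖) := by
          gcongr; exact norm_add_le _ _
      _ ≤ C + D := by linarith [hC x hx τ hτ, hD x hx τ hτ]

theorem time_smul [NormedSpace ℝ E] {f : ℝ → ℝ → E} (hf : RapidDecay f) {c : ℝ → ℝ}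
    (hc : ContinuousOn c (Set.Ioi 0)) : RapidDecay (fun x τ => c τ • f x τ) where
  cont := (hc.comp continuousOn_snd fun p hp => hp.2).smul hf.cont
  bound k δ T hδ := by
    obtain ⟨C, hC⟩ := hf.bound k δ T hδ
    obtain ⟨D, hD⟩ := (isCompact_Icc (a := δ) (b := T)).exists_bound_of_continuousOn
      (hc.mono fun t ht => hδ.trans_le ht.1)
    refine ⟨D * C, fun x hx τ hτ => ?_⟩
    calc (1 + x) ^ k * ‖c τ • f x τ‖ = ‖c τ‖ * ((1 + x) ^ k * ‖f x τ‖) := by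
          rw [norm_smul]; ring
      _ ≤ D * C := mul_le_mul (hD τ hτ) (hC x hx τ hτ) (by positivity)
          ((norm_nonneg _).trans (hD τ hτ))

theorem space_smul [NormedSpace ℝ E] {f : ℝ → ℝ → E} (hf : RapidDecay f) :
    RapidDecay (fun x τ => x • f x τ) where
  cont := continuousOn_fst.smul hf.cont
  bound k δ T hδ := by
    obtain ⟨C, hC⟩ := hf.bound (k + 1) δ T hδ
    refine ⟨C, fun x hx τ hτ => le_trans ?_ (hC x hx τ hτ)⟩
    rw [norm_smul, Real.norm_of_nonneg hx, pow_succ, mul_assoc]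
    gcongr
    linarith

theorem const_mul {f : ℝ → ℝ → ℂ} (hf : RapidDecay f) (c : ℂ) :
    RapidDecay (fun x τ => c * f x τ) where
  cont := continuousOn_const.mul hf.cont
  bound k δ T hδ := by
    obtain ⟨C, hC⟩ := hf.bound k δ T hδ
    refine ⟨‖c‖ * C, fun x hx τ hτ => ?_⟩
    calc (1 + x) ^ k * ‖c * f x τ‖ = ‖c‖ * ((1 + x) ^ k * ‖f x τ‖) := by
          rw [norm_mul]; ring
      _ ≤ ‖c‖ * C := by gcongr; exact hC x hx τ hτ

theorem inner [InnerProductSpace ℝ E] {f g : ℝ → ℝ → E} (hf : RapidDecay f)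
    (hg : RapidDecay g) : RapidDecay (fun x τ => Inner.inner ℝ (f x τ) (g x τ)) where
  cont := continuous_inner.comp_continuousOn (hf.cont.prodMk hg.cont)
  bound k δ T hδ := by
    obtain ⟨C, hC⟩ := hf.bound k δ T hδ
    obtain ⟨D, hD⟩ := hg.bound 0 δ T hδ
    refine ⟨C * D, fun x hx τ hτ => ?_⟩
    have hD' := hD x hx τ hτ
    rw [pow_zero, one_mul] at hD'
    calc (1 + x) ^ k * ‖Inner.inner ℝ (f x τ) (g x τ)‖
        ≤ (1 + x) ^ k * (‖f x τ‖ * ‖g x τ‖) := by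
          gcongr; exact norm_inner_le_norm _ _
      _ = ((1 + x) ^ k * ‖f x τ‖) * ‖g x τ‖ := by ring
      _ ≤ C * D := mul_le_mul (hC x hx τ hτ) hD' (norm_nonneg _)
          (le_trans (by positivity) (hC x hx τ hτ))

theorem exists_dominated {f : ℝ → ℝ → E} (hf : RapidDecay f) {δ T : ℝ} (hδ : 0 < δ) :
    ∃ C : ℝ, ∀ x, 0 ≤ x → ∀ τ ∈ Set.Icc δ T, ‖f x τ‖ ≤ C * (1 + x ^ 2)⁻¹ := by
  obtain ⟨C, hC⟩ := hf.bound 2 δ T hδ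
  refine ⟨C, fun x hx τ hτ => ?_⟩
  rw [← div_eq_mul_inv, le_div_iff₀ (by positivity)]
  refine le_trans ?_ (hC x hx τ hτ)
  rw [mul_comm]
  gcongr
  nlinarith

theorem integrableOn {f : ℝ → ℝ → E} (hf : RapidDecay f) {τ : ℝ} (hτ : 0 < τ) :
    IntegrableOn (fun x => f x τ) (Set.Ioi 0) := by
  obtain ⟨C, hC⟩ := hf.exists_dominated (T := τ) hτ
  refine Integrable.mono' (integrable_inv_one_add_sq.const_mul C).integrableOn
    (((hf.continuousOn_slice hτ).mono Ioi_subset_Ici_self).aestronglyMeasurable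
      measurableSet_Ioi) ?_
  filter_upwards [ae_restrict_mem measurableSet_Ioi] with x hx
  exact hC x (le_of_lt hx) τ ⟨le_rfl, le_rfl⟩

theorem tendsto_zero {f : ℝ → ℝ → E} (hf : RapidDecay f) {τ : ℝ} (hτ : 0 < τ) :
    Tendsto (fun x => f x τ) atTop (nhds 0) := by
  obtain ⟨C, hC⟩ := hf.bound 1 τ τ hτ
  have h : Tendsto (fun x : ℝ => C / (1 + x)) atTop (nhds 0) :=
    tendsto_const_nhds.div_atTop (tendsto_atTop_add_const_left _ _ tendsto_id)
  refine squeeze_zero_norm' ?_ h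
  filter_upwards [eventually_ge_atTop 0] with x hx
  rw [le_div_iff₀ (by positivity)]
  have := hC x hx τ ⟨le_rfl, le_rfl⟩
  rwa [pow_one, mul_comm] at this

theorem integral_deriv_space [NormedSpace ℝ E] [CompleteSpace E] {P Q : ℝ → ℝ → E}
    (hP : RapidDecay P) (hQ : RapidDecay Q) {τ : ℝ} (hτ : 0 < τ)
    (h : ∀ x, 0 < x → HasDerivAt (fun y => P y τ) (Q x τ) x) :
    ∫ x in Set.Ioi 0, Q x τ = -P 0 τ := by
  have := integral_Ioi_of_hasDerivAt_of_tendsto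
    ((hP.continuousOn_slice hτ) 0 (by simp)) h (hQ.integrableOn hτ) (hP.tendsto_zero hτ)
  simpa using this

theorem hasDerivAt_integral [NormedSpace ℝ E] {P Q : ℝ → ℝ → E}
    (hP : RapidDecay P) (hQ : RapidDecay Q)
    (h : ∀ x, 0 < x → ∀ τ, 0 < τ → HasDerivAt (fun s => P x s) (Q x τ) τ)
    {τ : ℝ} (hτ : 0 < τ) :
    HasDerivAt (fun s => ∫ x in Set.Ioi 0, P x s) (∫ x in Set.Ioi 0, Q x τ) τ := by
  obtain ⟨C, hC⟩ := hQ.exists_dominated (δ := τ / 2) (T := 2 * τ) (by positivity)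
  refine (hasDerivAt_integral_of_dominated_loc_of_deriv_le
    (F := fun s x => P x s) (F' := fun s x => Q x s) (s := Set.Ioo (τ / 2) (2 * τ))
    (bound := fun x => C * (1 + x ^ 2)⁻¹)
    (Ioo_mem_nhds (by linarith) (by linarith)) ?_ (hP.integrableOn hτ)
    (hQ.integrableOn hτ).aestronglyMeasurable ?_
    (integrable_inv_one_add_sq.const_mul C).integrableOn ?_).2
  · filter_upwards [lt_mem_nhds hτ] with s hs
    exact (hP.integrableOn hs).aestronglyMeasurable
  · filter_upwards [ae_restrict_mem measurableSet_Ioi] with x hx s hs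
    exact hC x (le_of_lt hx) s ⟨hs.1.le, hs.2.le⟩
  · filter_upwards [ae_restrict_mem measurableSet_Ioi] with x hx s hs
    exact h x hx s (by linarith [hs.1])

theorem hasDerivAt_integral_norm_sq [InnerProductSpace ℝ E] {f g : ℝ → ℝ → E}
    (hf : RapidDecay f) (hg : RapidDecay g)
    (h : ∀ x, 0 < x → ∀ τ, 0 < τ → HasDerivAt (fun s => f x s) (g x τ) τ)
    {τ : ℝ} (hτ : 0 < τ) :
    HasDerivAt (fun s => ∫ x in Set.Ioi 0, ‖f x s‖ ^ 2)
      (∫ x in Set.Ioi 0, 2 * Inner.inner ℝ (f x τ) (g x τ)) τ := by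
  refine hasDerivAt_integral (P := fun x s => ‖f x s‖ ^ 2)
    (Q := fun x s => 2 * Inner.inner ℝ (f x s) (g x s)) ?_ ?_
    (fun x hx s hs => (h x hx s hs).norm_sq) hτ
  · simpa only [real_inner_self_eq_norm_sq] using hf.inner hf
  · exact (hf.inner hg).time_smul (c := fun _ => 2) continuousOn_const

theorem abs_integral_inner_le [InnerProductSpace ℝ E] {f g : ℝ → ℝ → E}
    (hf : RapidDecay f) (hg : RapidDecay g) {τ : ℝ} (hτ : 0 < τ) :
    |∫ x in Set.Ioi 0, Inner.inner ℝ (f x τ) (g x τ)| ≤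
      √(∫ x in Set.Ioi 0, ‖f x τ‖ ^ 2) * √(∫ x in Set.Ioi 0, ‖g x τ‖ ^ 2) := by
  have hff := (hf.inner hf).integrableOn hτ
  have hfg := (hf.inner hg).integrableOn hτ
  have hgg := (hg.inner hg).integrableOn hτ
  simp only [real_inner_self_eq_norm_sq] at hff hgg
  have key : ∀ t : ℝ, 0 ≤ (∫ x in Set.Ioi 0, ‖f x τ‖ ^ 2) * (t * t) +
      (2 * ∫ x in Set.Ioi 0, Inner.inner ℝ (f x τ) (g x τ)) * t +
      ∫ x in Set.Ioi 0, ‖g x τ‖ ^ 2 := fun t => by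
    have h0 : 0 ≤ ∫ x in Set.Ioi 0, ‖t • f x τ + g x τ‖ ^ 2 :=
      integral_nonneg fun x => by positivity
    have h1 : ∀ x, ‖t • f x τ + g x τ‖ ^ 2 =
        (t * t) * ‖f x τ‖ ^ 2 + (2 * t) * Inner.inner ℝ (f x τ) (g x τ) + ‖g x τ‖ ^ 2 :=
      fun x => by
        rw [norm_add_sq_real, norm_smul, real_inner_smul_left, mul_pow, Real.norm_eq_abs, sq_abs]
        ring
    have h2 := integral_add ((hff.const_mul (t * t)).add (hfg.const_mul (2 * t))) hgg
    simp only [Pi.add_apply] at h2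
    simp only [h1] at h0
    rw [h2, integral_add (hff.const_mul _) (hfg.const_mul _), integral_const_mul,
      integral_const_mul] at h0
    linarith
  have hd := discrim_le_zero key
  rw [discrim] at hd
  rw [← Real.sqrt_mul (integral_nonneg fun x => by positivity)]
  exact Real.abs_le_sqrt (by nlinarith)

end RapidDecay

end RapidDecay

section PartialDerivatives

/-- Partial derivative in the first variable, one-sided on the boundary of the quarter plane. -/
def dx (F : ℝ → ℝ → ℂ) : ℝ → ℝ → ℂ := fun x τ => fderivWithin ℝ (uncurry F) quarter (x, τ) (1, 0)

/-- Partial derivative in the second variable within the quarter plane. -/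
def dt (F : ℝ → ℝ → ℂ) : ℝ → ℝ → ℂ := fun x τ => fderivWithin ℝ (uncurry F) quarter (x, τ) (0, 1)

theorem uniqueDiffOn_quarter : UniqueDiffOn ℝ quarter :=
  (uniqueDiffOn_Ici 0).prod isOpen_Ioi.uniqueDiffOn

theorem quarter_mem_nhds {x τ : ℝ} (hx : 0 < x) (hτ : 0 < τ) : quarter ∈ nhds (x, τ) :=
  prod_mem_nhds (Ici_mem_nhds hx) (Ioi_mem_nhds hτ)

variable {F : ℝ → ℝ → ℂ}

theorem contDiffOn_dx (hF : ContDiffOn ℝ (⊤ : ℕ∞) (uncurry F) quarter) :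
    ContDiffOn ℝ (⊤ : ℕ∞) (uncurry (dx F)) quarter :=
  (hF.fderivWithin uniqueDiffOn_quarter (m := (⊤ : ℕ∞)) (by simp)).clm_apply contDiffOn_const

theorem contDiffOn_dt (hF : ContDiffOn ℝ (⊤ : ℕ∞) (uncurry F) quarter) :
    ContDiffOn ℝ (⊤ : ℕ∞) (uncurry (dt F)) quarter :=
  (hF.fderivWithin uniqueDiffOn_quarter (m := (⊤ : ℕ∞)) (by simp)).clm_apply contDiffOn_const

theorem hasFDerivAt_quarter (hF : ContDiffOn ℝ (⊤ : ℕ∞) (uncurry F) quarter)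
    {x τ : ℝ} (hx : 0 < x) (hτ : 0 < τ) :
    HasFDerivAt (uncurry F) (fderivWithin ℝ (uncurry F) quarter (x, τ)) (x, τ) :=
  ((hF.differentiableOn (by simp)) (x, τ) ⟨hx.le, hτ⟩).hasFDerivWithinAt.hasFDerivAt
    (quarter_mem_nhds hx hτ)

theorem hasDerivAt_dx (hF : ContDiffOn ℝ (⊤ : ℕ∞) (uncurry F) quarter)
    {x τ : ℝ} (hx : 0 < x) (hτ : 0 < τ) :
    HasDerivAt (fun y => F y τ) (dx F x τ) x :=
  (hasFDerivAt_quarter hF hx hτ).comp_hasDerivAt (f := fun y : ℝ => (y, τ)) x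
    ((hasDerivAt_id x).prodMk (hasDerivAt_const x τ))

theorem hasDerivAt_dt (hF : ContDiffOn ℝ (⊤ : ℕ∞) (uncurry F) quarter)
    {x τ : ℝ} (hx : 0 ≤ x) (hτ : 0 < τ) :
    HasDerivAt (fun s => F x s) (dt F x τ) τ := by
  have h := ((hF.differentiableOn (by simp)) (x, τ) ⟨hx, hτ⟩).hasFDerivWithinAt
  have h2 := h.comp_hasDerivWithinAt (f := fun s : ℝ => (x, s)) (s := Set.Ioi 0) τ
    ((hasDerivAt_const τ x).prodMk (hasDerivAt_id τ)).hasDerivWithinAt fun s hs => ⟨hx, hs⟩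
  exact h2.hasDerivAt (Ioi_mem_nhds hτ)

theorem continuousOn_space_slice (hF : ContDiffOn ℝ (⊤ : ℕ∞) (uncurry F) quarter)
    {τ : ℝ} (hτ : 0 < τ) :
    ContinuousOn (fun x => F x τ) (Set.Ici 0) :=
  hF.continuousOn.comp (f := fun x : ℝ => (x, τ)) (by fun_prop) fun _ hx => ⟨hx, hτ⟩

theorem dt_dx_eq_dx_dt (hF : ContDiffOn ℝ (⊤ : ℕ∞) (uncurry F) quarter)
    {x τ : ℝ} (hx : 0 < x) (hτ : 0 < τ) :
    dt (dx F) x τ = dx (dt F) x τ := by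
  have hmem : (x, τ) ∈ quarter := ⟨hx.le, hτ⟩
  have hd := ((hF.fderivWithin uniqueDiffOn_quarter (m := (⊤ : ℕ∞)) (by simp)).differentiableOn
    (by simp)) (x, τ) hmem
  have key : ∀ v w : ℝ × ℝ, fderivWithin ℝ (fun p => fderivWithin ℝ (uncurry F) quarter p v)
      quarter (x, τ) w =
      fderivWithin ℝ (fderivWithin ℝ (uncurry F) quarter) quarter (x, τ) w v := fun v w => by
    rw [fderivWithin_clm_apply (uniqueDiffOn_quarter _ hmem) hd (differentiableWithinAt_const v)]
    simp
  have hs : IsSymmSndFDerivWithinAt ℝ (uncurry F) quarter (x, τ) :=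
    (hF (x, τ) hmem).isSymmSndFDerivWithinAt
      (by rw [minSmoothness_of_isRCLikeNormedField]; exact WithTop.coe_le_coe.2 (le_top : (2 : ℕ∞) ≤ ⊤))
      uniqueDiffOn_quarter
      (subset_closure (mem_interior_iff_mem_nhds.2 (quarter_mem_nhds hx hτ))) hmem
  exact (key (1, 0) (0, 1)).trans ((hs (0, 1) (1, 0)).trans (key (0, 1) (1, 0)).symm)

end PartialDerivatives

section EnergyEstimates

variable {H₀ H₁ H₂ H₃ : ℝ → ℝ → ℂ} {b b' : ℝ → ℝ}

theorem hasDerivAt_gradient_energy (r₁ : RapidDecay H₁) (r₂ : RapidDecay H₂)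
    (r₃ : RapidDecay H₃) (hb' : ContinuousOn b' (Set.Ioi 0))
    (hx₁ : ∀ x, 0 < x → ∀ τ, 0 < τ → HasDerivAt (fun y => H₁ y τ) (H₂ x τ) x)
    (hx₂ : ∀ x, 0 < x → ∀ τ, 0 < τ → HasDerivAt (fun y => H₂ y τ) (H₃ x τ) x)
    (ht : ∀ x, 0 < x → ∀ τ, 0 < τ →
      HasDerivAt (fun s => H₁ x s) (b' τ • H₂ x τ + -(Complex.I / 2) * H₃ x τ) τ)
    (hbc : ∀ τ, 0 < τ → b' τ • H₁ 0 τ + -(Complex.I / 2) * H₂ 0 τ = 0)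
    {τ : ℝ} (hτ : 0 < τ) :
    HasDerivAt (fun s => ∫ x in Set.Ioi 0, ‖H₁ x s‖ ^ 2) (b' τ * ‖H₁ 0 τ‖ ^ 2) τ := by
  have rR := (r₂.time_smul hb').add (r₃.const_mul (-(Complex.I / 2)))
  have rQ := (r₁.inner rR).time_smul (c := fun _ => 2) continuousOn_const
  have rP := ((r₁.inner r₁).time_smul hb').add (r₁.inner (r₂.const_mul (-Complex.I)))
  have hE := RapidDecay.hasDerivAt_integral_norm_sq r₁ rR ht hτ
  have hI := RapidDecay.integral_deriv_space rP rQ hτ fun x hx => by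
    have h1 := hx₁ x hx τ hτ
    have h2 := hx₂ x hx τ hτ
    refine (((h1.inner ℝ h1).const_mul (b' τ)).add
      (h1.inner ℝ (h2.const_mul (-Complex.I)))).congr_deriv ?_
    simp [Complex.inner]
    ring
  simp only [smul_eq_mul] at hI
  rw [hI] at hE
  convert hE using 1
  have h0 : -Complex.I * H₂ 0 τ = (-2 * b' τ) • H₁ 0 τ := by
    have := hbc τ hτ
    simp only [Complex.real_smul] at this ⊢
    push_cast
    linear_combination 2 * this
  rw [h0, real_inner_smul_right, real_inner_self_eq_norm_sq]
  ring

theorem hasDerivAt_weighted_energy (r₀ : RapidDecay H₀) (r₁ : RapidDecay H₁)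
    (r₂ : RapidDecay H₂) (hb : ∀ τ, 0 < τ → HasDerivAt b (b' τ) τ)
    (hb' : ContinuousOn b' (Set.Ioi 0))
    (hx₀ : ∀ x, 0 < x → ∀ τ, 0 < τ → HasDerivAt (fun y => H₀ y τ) (H₁ x τ) x)
    (hx₁ : ∀ x, 0 < x → ∀ τ, 0 < τ → HasDerivAt (fun y => H₁ y τ) (H₂ x τ) x)
    (ht : ∀ x, 0 < x → ∀ τ, 0 < τ →
      HasDerivAt (fun s => H₀ x s) (b' τ • H₁ x τ + -(Complex.I / 2) * H₂ x τ) τ)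
    (hbc : ∀ τ, 0 < τ → H₀ 0 τ = 0) {τ : ℝ} (hτ : 0 < τ) :
    HasDerivAt (fun s => ∫ x in Set.Ioi 0, ‖(x + b s) • H₀ x s‖ ^ 2)
      (-2 * ∫ x in Set.Ioi 0, inner ℝ ((x + b τ) • H₀ x τ) (-Complex.I * H₁ x τ)) τ := by
  have hbc' : ContinuousOn b (Set.Ioi 0) := fun s hs =>
    (hb s hs).continuousAt.continuousWithinAt
  have weight : ∀ {f : ℝ → ℝ → ℂ}, RapidDecay f → RapidDecay fun x τ => (x + b τ) • f x τ :=
    fun hf => by simpa only [add_smul] using hf.space_smul.add (hf.time_smul hbc')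
  have rK := weight r₀
  have rR := (r₁.time_smul hb').add (r₂.const_mul (-(Complex.I / 2)))
  have rKt := (r₀.time_smul hb').add (weight rR)
  have rI := r₁.const_mul (-Complex.I)
  have rQ₁ := (rK.inner rKt).time_smul (c := fun _ => 2) continuousOn_const
  have rQ₂ := (rK.inner rI).time_smul (c := fun _ => 2) continuousOn_const
  have rP := ((rK.inner rK).time_smul hb').add (rK.inner (weight rI))
  have hW := RapidDecay.hasDerivAt_integral_norm_sq rK rKt (fun x hx s hs => by
    exact (((hb s hs).const_add x).smul (ht x hx s hs)).congr_deriv (add_comm _ _)) hτ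
  have hI := RapidDecay.integral_deriv_space rP (rQ₁.add rQ₂) hτ fun x hx => by
    have h0 := hx₀ x hx τ hτ
    have h1 := hx₁ x hx τ hτ
    have hw : HasDerivAt (fun y => y + b τ) 1 x := (hasDerivAt_id x).add_const _
    have hK := hw.smul h0
    refine (((hK.inner ℝ hK).const_mul (b' τ)).add
      (hK.inner ℝ (hw.smul (h1.const_mul (-Complex.I))))).congr_deriv ?_
    simp [Complex.inner]
    ring
  have hadd := integral_add (rQ₁.integrableOn hτ) (rQ₂.integrableOn hτ)
  simp only [smul_eq_mul] at hI hadd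
  rw [hadd] at hI
  convert hW using 1
  rw [integral_const_mul] at hI
  have hP : b' τ * inner ℝ ((0 + b τ) • H₀ 0 τ) ((0 + b τ) • H₀ 0 τ) +
      inner ℝ ((0 + b τ) • H₀ 0 τ) ((0 + b τ) • (-Complex.I * H₁ 0 τ)) = 0 := by
    simp [hbc τ hτ]
  rw [hP, integral_const_mul] at hI
  rw [integral_const_mul]
  linarith

/-- If `W' ≥ -2 M √W` then `√W` grows at most at rate `M` backwards in time. -/
theorem sqrt_le_add_of_deriv_ge {W W' : ℝ → ℝ} {M a c : ℝ} (hM : 0 ≤ M) (hac : a ≤ c)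
    (hW : ∀ s ∈ Set.Icc a c, 0 ≤ W s)
    (hd : ∀ s ∈ Set.Icc a c, HasDerivAt W (W' s) s)
    (hW' : ∀ s ∈ Set.Icc a c, -(2 * M * √(W s)) ≤ W' s) :
    √(W a) ≤ √(W c) + M * (c - a) := by
  have step : ∀ ε > 0, √(W a + ε) ≤ √(W c + ε) + M * (c - a) := fun ε hε => by
    have hder : ∀ s ∈ Set.Icc a c,
        HasDerivAt (fun s => √(W s + ε) + M * s) (W' s / (2 * √(W s + ε)) + M * 1) s :=
      fun s hs => (((hd s hs).add_const ε).sqrt (by linarith [hW s hs])).add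
        ((hasDerivAt_id s).const_mul M)
    have hmono : MonotoneOn (fun s => √(W s + ε) + M * s) (Set.Icc a c) := by
      refine monotoneOn_of_deriv_nonneg (convex_Icc a c)
        (fun s hs => (hder s hs).continuousAt.continuousWithinAt)
        (fun s hs => (hder s (interior_subset hs)).differentiableAt.differentiableWithinAt)
        fun s hs => ?_
      have hs' := interior_subset hs
      have hpos : 0 < √(W s + ε) := Real.sqrt_pos.2 (by linarith [hW s hs'])
      have hle : √(W s) ≤ √(W s + ε) := Real.sqrt_le_sqrt (by linarith)
      rw [(hder s hs').deriv, mul_one, ← sub_neg_eq_add, sub_nonneg,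
        le_div_iff₀ (by positivity)]
      nlinarith [hW' s hs', mul_le_mul_of_nonneg_left hle hM]
    have := hmono (left_mem_Icc.2 hac) (right_mem_Icc.2 hac) hac
    simp only at this
    linarith
  have lim : ∀ v : ℝ, Tendsto (fun ε => √(v + ε)) (nhdsWithin 0 (Set.Ioi 0)) (nhds √v) :=
    fun v => by
      have h : Continuous fun ε : ℝ => √(v + ε) := by fun_prop
      simpa using (h.tendsto 0).mono_left nhdsWithin_le_nhds
  exact le_of_tendsto_of_tendsto (lim _) ((lim _).add_const _)
    (eventually_nhdsWithin_of_forall step)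

theorem sqrt_weighted_energy_le (r₀ : RapidDecay H₀) (r₁ : RapidDecay H₁)
    (r₂ : RapidDecay H₂) (r₃ : RapidDecay H₃) (hb : ∀ τ, 0 < τ → HasDerivAt b (b' τ) τ)
    (hb' : ContinuousOn b' (Set.Ioi 0)) (hb'_nonneg : ∀ τ, 0 < τ → 0 ≤ b' τ)
    (hx₀ : ∀ x, 0 < x → ∀ τ, 0 < τ → HasDerivAt (fun y => H₀ y τ) (H₁ x τ) x)
    (hx₁ : ∀ x, 0 < x → ∀ τ, 0 < τ → HasDerivAt (fun y => H₁ y τ) (H₂ x τ) x)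
    (hx₂ : ∀ x, 0 < x → ∀ τ, 0 < τ → HasDerivAt (fun y => H₂ y τ) (H₃ x τ) x)
    (ht₀ : ∀ x, 0 < x → ∀ τ, 0 < τ →
      HasDerivAt (fun s => H₀ x s) (b' τ • H₁ x τ + -(Complex.I / 2) * H₂ x τ) τ)
    (ht₁ : ∀ x, 0 < x → ∀ τ, 0 < τ →
      HasDerivAt (fun s => H₁ x s) (b' τ • H₂ x τ + -(Complex.I / 2) * H₃ x τ) τ)
    (hbc₀ : ∀ τ, 0 < τ → H₀ 0 τ = 0)
    (hbc₁ : ∀ τ, 0 < τ → b' τ • H₁ 0 τ + -(Complex.I / 2) * H₂ 0 τ = 0)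
    {τ τ₁ : ℝ} (hτ : 0 < τ) (hτ₁ : τ ≤ τ₁) :
    √(∫ x in Set.Ioi 0, ‖(x + b τ) • H₀ x τ‖ ^ 2) ≤
      √(∫ x in Set.Ioi 0, ‖(x + b τ₁) • H₀ x τ₁‖ ^ 2) +
        √(∫ x in Set.Ioi 0, ‖H₁ x τ₁‖ ^ 2) * (τ₁ - τ) := by
  have hEder := fun s (hs : (0 : ℝ) < s) =>
    hasDerivAt_gradient_energy r₁ r₂ r₃ hb' hx₁ hx₂ ht₁ hbc₁ hs
  have hEmono : MonotoneOn (fun s => ∫ x in Set.Ioi 0, ‖H₁ x s‖ ^ 2) (Set.Ioi 0) := by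
    refine monotoneOn_of_deriv_nonneg (convex_Ioi 0)
      (fun s hs => (hEder s hs).continuousAt.continuousWithinAt)
      (fun s hs => (hEder s (interior_subset hs)).differentiableAt.differentiableWithinAt)
      fun s hs => ?_
    have hs' : 0 < s := interior_subset hs
    rw [(hEder s hs').deriv]
    exact mul_nonneg (hb'_nonneg s hs') (by positivity)
  have hbc' : ContinuousOn b (Set.Ioi 0) := fun s hs =>
    (hb s hs).continuousAt.continuousWithinAt
  have rK : RapidDecay fun x τ => (x + b τ) • H₀ x τ := by
    simpa only [add_smul] using r₀.space_smul.add (r₀.time_smul hbc')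
  refine sqrt_le_add_of_deriv_ge (W := fun s => ∫ x in Set.Ioi 0, ‖(x + b s) • H₀ x s‖ ^ 2)
    (Real.sqrt_nonneg _) hτ₁ (fun s _ => integral_nonneg fun x => by positivity)
    (fun s hs => hasDerivAt_weighted_energy r₀ r₁ r₂ hb hb' hx₀ hx₁ ht₀ hbc₀
      (hτ.trans_le hs.1)) fun s hs => ?_
  have hs0 : 0 < s := hτ.trans_le hs.1
  have hCS := (abs_le.1 (rK.abs_integral_inner_le (r₁.const_mul (-Complex.I)) hs0)).2
  simp only [norm_mul, norm_neg, Complex.norm_I, one_mul] at hCS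
  have hE := Real.sqrt_le_sqrt (hEmono hs0 (hs0.trans_le hs.2) hs.2)
  have := mul_le_mul_of_nonneg_left hE
    (Real.sqrt_nonneg (∫ x in Set.Ioi 0, ‖(x + b s) • H₀ x s‖ ^ 2))
  simp only at this ⊢
  nlinarith

end EnergyEstimates

section Flattening

/-- The boundary curve `η = -1/(6τ²)`. -/
def bdry (τ : ℝ) : ℝ := -1 / (6 * τ ^ 2)

/-- The speed of the boundary curve. -/
def bdrySpeed (τ : ℝ) : ℝ := 1 / (3 * τ ^ 3)

theorem hasDerivAt_bdry {τ : ℝ} (hτ : 0 < τ) : HasDerivAt bdry (bdrySpeed τ) τ := by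
  have h := (hasDerivAt_const τ (-1 : ℝ)).div (((hasDerivAt_id τ).pow 2).const_mul 6)
    (by simp [hτ.ne'])
  refine h.congr_deriv ?_
  simp only [Pi.pow_apply, id, bdrySpeed]
  field_simp
  norm_num
  ring

theorem continuousOn_bdrySpeed : ContinuousOn bdrySpeed (Set.Ioi 0) :=
  continuousOn_const.div (by fun_prop) fun τ (hτ : 0 < τ) => by positivity

theorem setIntegral_Ioi_eq_comp_add (f : ℝ → ℝ) (a : ℝ) :
    ∫ η in Set.Ioi a, f η = ∫ x in Set.Ioi 0, f (x + a) := by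
  have h := (measurePreserving_add_right volume a).setIntegral_preimage_emb
    (MeasurableEquiv.addRight a).measurableEmbedding f (Set.Ioi a)
  rw [← h]
  simp

/-- The solution in coordinates that straighten the boundary curve. -/
def flatten (G : ℝ → ℝ → ℂ) : ℝ → ℝ → ℂ := fun x τ => G (x + bdry τ) τ

variable {G : ℝ → ℝ → ℂ}

theorem contDiffOn_flatten (hG : IsAdmissibleTr G) :
    ContDiffOn ℝ (⊤ : ℕ∞) (uncurry (flatten G)) quarter := by
  have hmap : ContDiffOn ℝ (⊤ : ℕ∞) (fun p : ℝ × ℝ => (p.1 + bdry p.2, p.2)) quarter := by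
    refine (contDiffOn_fst.add (ContDiffOn.div contDiffOn_const
      (contDiffOn_const.mul (contDiffOn_snd.pow 2)) fun p hp => ?_)).prodMk contDiffOn_snd
    have : 0 < p.2 := hp.2
    positivity
  refine hG.smooth.comp hmap fun p hp => ⟨hp.2, ?_⟩
  have : 0 ≤ p.1 := hp.1
  simp only [bdry]
  linarith

theorem contDiffOn_iterate_dx_flatten (hG : IsAdmissibleTr G) (n : ℕ) :
    ContDiffOn ℝ (⊤ : ℕ∞) (uncurry (dx^[n] (flatten G))) quarter := by
  induction n with
  | zero => exact contDiffOn_flatten hG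
  | succ n ih => rw [iterate_succ_apply']; exact contDiffOn_dx ih

theorem iterate_dx_flatten (hG : IsAdmissibleTr G) (n : ℕ) {x τ : ℝ} (hx : 0 < x) (hτ : 0 < τ) :
    (dx^[n] (flatten G)) x τ = (pdX^[n] G) (x + bdry τ) τ := by
  induction n generalizing x with
  | zero => rfl
  | succ n ih =>
    rw [iterate_succ_apply', iterate_succ_apply']
    have h := hasDerivAt_dx (contDiffOn_iterate_dx_flatten hG n) hx hτ
    rw [← add_sub_cancel_right x (bdry τ)] at h
    have h' := h.comp_sub_const (x + bdry τ) (bdry τ)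
    rw [add_sub_cancel_right] at h'
    refine (HasDerivAt.deriv (h'.congr_of_eventuallyEq ?_)).symm
    filter_upwards [lt_mem_nhds (show bdry τ < x + bdry τ by linarith)] with y hy
    rw [ih (sub_pos.2 hy), sub_add_cancel]

theorem rapidDecay_iterate_dx_flatten (hG : IsAdmissibleTr G) (n : ℕ) :
    RapidDecay (dx^[n] (flatten G)) where
  cont := (contDiffOn_iterate_dx_flatten hG n).continuousOn
  bound k δ T hδ := by
    obtain ⟨X, hX⟩ := hG.decay k 0 n δ (max T (δ + 1)) hδ
      (lt_of_lt_of_le (by linarith) (le_max_right _ _)) 1 one_pos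
    set B : ℝ := 1 / (6 * δ ^ 2) with hB
    have hB0 : 0 < B := by positivity
    set X₀ : ℝ := max X 0 + 1 + 2 * B
    have hcont : ContinuousOn (fun p : ℝ × ℝ => (1 + p.1) ^ k * ‖(dx^[n] (flatten G)) p.1 p.2‖)
        (Set.Icc 0 X₀ ×ˢ Set.Icc δ T) :=
      ContinuousOn.mul (by fun_prop) ((contDiffOn_iterate_dx_flatten hG n).continuousOn.mono
        fun p hp => ⟨hp.1.1, hδ.trans_le hp.2.1⟩).norm
    obtain ⟨C, hC⟩ := (isCompact_Icc.prod isCompact_Icc).exists_bound_of_continuousOn hcont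
    refine ⟨max C (2 ^ k), fun x hx τ hτ => ?_⟩
    rcases le_total x X₀ with hxX | hxX
    · exact le_max_of_le_left ((le_abs_self _).trans (hC (x, τ) ⟨⟨hx, hxX⟩, hτ⟩))
    · refine le_max_of_le_right ?_
      have hτ0 : 0 < τ := hδ.trans_le hτ.1
      have hb : -B ≤ bdry τ := by
        rw [hB, bdry, neg_div, neg_le_neg_iff]
        gcongr
        exact hτ.1
      have hX1 := le_max_left X 0
      have hX2 := le_max_right X 0
      have hx0 : 0 < x := by linarith
      rw [iterate_dx_flatten hG n hx0 hτ0]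
      have hη := hX (x + bdry τ) (by linarith) τ ⟨hτ.1, hτ.2.trans (le_max_left _ _)⟩
      rw [iterate_zero_apply] at hη
      calc (1 + x) ^ k * ‖(pdX^[n] G) (x + bdry τ) τ‖
          ≤ (2 * (x + bdry τ)) ^ k * ‖(pdX^[n] G) (x + bdry τ) τ‖ := by
            gcongr
            linarith
        _ = 2 ^ k * ((x + bdry τ) ^ k * ‖(pdX^[n] G) (x + bdry τ) τ‖) := by
            rw [mul_pow, mul_assoc]
        _ ≤ 2 ^ k * 1 := by gcongr
        _ = 2 ^ k := mul_one _

theorem dt_flatten (hG : IsAdmissibleTr G) {x τ : ℝ} (hx : 0 < x) (hτ : 0 < τ) :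
    dt (flatten G) x τ = bdrySpeed τ • dx (flatten G) x τ +
      -(Complex.I / 2) * dx (dx (flatten G)) x τ := by
  have hF := hasFDerivAt_quarter (contDiffOn_flatten hG) hx hτ
  have hcurve : HasDerivAt (fun s : ℝ => (x + bdry τ - bdry s, s)) (-bdrySpeed τ, (1 : ℝ)) τ :=
    ((hasDerivAt_bdry hτ).const_sub _).prodMk (hasDerivAt_id τ)
  have hpt : (x + bdry τ - bdry τ, τ) = (x, τ) := by rw [add_sub_cancel_right]
  have hpd : pdT G (x + bdry τ) τ = dt (flatten G) x τ - bdrySpeed τ • dx (flatten G) x τ := by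
    have h := HasFDerivAt.comp_hasDerivAt (l := uncurry (flatten G))
      (l' := fderivWithin ℝ (uncurry (flatten G)) quarter (x, τ)) τ (by rwa [hpt]) hcurve
    have hfun : uncurry (flatten G) ∘ (fun s : ℝ => (x + bdry τ - bdry s, s)) =
        fun s => G (x + bdry τ) s := by
      funext s
      simp [flatten]
    rw [hfun] at h
    have hv : ((-bdrySpeed τ, 1) : ℝ × ℝ) = (0, 1) - bdrySpeed τ • (1, 0) := by simp
    rw [hv, map_sub, map_smul] at h
    exact h.deriv
  have heq := hG.eqn (x + bdry τ) τ hτ (by simp only [bdry]; linarith)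
  have h2 : pdX (pdX G) (x + bdry τ) τ = dx (dx (flatten G)) x τ :=
    (iterate_dx_flatten hG 2 hx hτ).symm
  rw [hpd, h2] at heq
  linear_combination (-Complex.I) * heq + (dt (flatten G) x τ -
    bdrySpeed τ • dx (flatten G) x τ) * Complex.I_mul_I

theorem hasDerivAt_time_dx_flatten (hG : IsAdmissibleTr G) {x τ : ℝ} (hx : 0 < x) (hτ : 0 < τ) :
    HasDerivAt (fun s => dx (flatten G) x s) (bdrySpeed τ • dx (dx (flatten G)) x τ +
      -(Complex.I / 2) * dx (dx (dx (flatten G))) x τ) τ := by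
  refine (hasDerivAt_dt (contDiffOn_iterate_dx_flatten hG 1) hx.le hτ).congr_deriv ?_
  refine (dt_dx_eq_dx_dt (contDiffOn_flatten hG) hx hτ).trans ?_
  refine (hasDerivAt_dx (contDiffOn_dt (contDiffOn_flatten hG)) hx hτ).unique ?_
  refine HasDerivAt.congr_of_eventuallyEq
    (((hasDerivAt_dx (contDiffOn_iterate_dx_flatten hG 1) hx hτ).const_smul (bdrySpeed τ)).add
      ((hasDerivAt_dx (contDiffOn_iterate_dx_flatten hG 2) hx hτ).const_mul (-(Complex.I / 2)))) ?_
  filter_upwards [lt_mem_nhds hx] with y hy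
  exact dt_flatten hG hy hτ

theorem flatten_zero (hG : IsAdmissibleTr G) {τ : ℝ} (hτ : 0 < τ) : flatten G 0 τ = 0 := by
  rw [flatten, zero_add]
  exact hG.bc τ hτ

theorem flatten_boundary_relation (hG : IsAdmissibleTr G) {τ : ℝ} (hτ : 0 < τ) :
    bdrySpeed τ • dx (flatten G) 0 τ + -(Complex.I / 2) * dx (dx (flatten G)) 0 τ = 0 := by
  have smooth₁ := contDiffOn_dx (contDiffOn_flatten hG)
  have smooth₂ := contDiffOn_dx smooth₁
  have cont₁ := continuousOn_space_slice smooth₁ hτ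
  have cont₂ := continuousOn_space_slice smooth₂ hτ
  have hcont : ContinuousOn (fun x => bdrySpeed τ • dx (flatten G) x τ +
      -(Complex.I / 2) * dx (dx (flatten G)) x τ) (Set.Ici 0) :=
    (cont₁.const_smul (bdrySpeed τ)).add (cont₂.const_mul (-(Complex.I / 2)))
  have hEq := Set.EqOn.of_subset_closure
    (fun x (hx : x ∈ Set.Ioi (0 : ℝ)) => dt_flatten hG hx hτ)
    (continuousOn_space_slice (contDiffOn_dt (contDiffOn_flatten hG)) hτ) hcont
    Ioi_subset_Ici_self (closure_Ioi (0 : ℝ)).ge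
  have hconst : HasDerivAt (fun s => flatten G 0 s) 0 τ := by
    refine (hasDerivAt_const τ (0 : ℂ)).congr_of_eventuallyEq ?_
    filter_upwards [lt_mem_nhds hτ] with s hs
    exact flatten_zero hG hs
  have h0 : dt (flatten G) 0 τ = 0 :=
    (hasDerivAt_dt (contDiffOn_flatten hG) le_rfl hτ).unique hconst
  have hEq0 := hEq (Set.self_mem_Ici (a := (0 : ℝ)))
  simp only at hEq0
  rw [← hEq0, h0]

theorem trNormW_eq (τ : ℝ) :
    trNormW G τ = √(∫ x in Set.Ioi 0, ‖(x + bdry τ) • flatten G x τ‖ ^ 2) := by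
  rw [trNormW, setIntegral_Ioi_eq_comp_add]
  simp only [norm_smul, mul_pow, Real.norm_eq_abs, sq_abs]
  rfl

theorem trNorm_pdX_eq (hG : IsAdmissibleTr G) {τ : ℝ} (hτ : 0 < τ) :
    trNorm (pdX G) τ = √(∫ x in Set.Ioi 0, ‖dx (flatten G) x τ‖ ^ 2) := by
  rw [trNorm, setIntegral_Ioi_eq_comp_add]
  congr 1
  refine setIntegral_congr_fun measurableSet_Ioi fun x hx => ?_
  exact congrArg (fun z : ℂ => ‖z‖ ^ 2) (iterate_dx_flatten hG 1 hx hτ).symm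

theorem trNormW_le (hG : IsAdmissibleTr G) {τ τ₁ : ℝ} (hτ : 0 < τ) (hτ₁ : τ ≤ τ₁) :
    trNormW G τ ≤ trNormW G τ₁ + τ₁ * trNorm (pdX G) τ₁ := by
  have smooth₀ := contDiffOn_flatten hG
  have smooth₁ := contDiffOn_dx smooth₀
  have smooth₂ := contDiffOn_dx smooth₁
  have decay := rapidDecay_iterate_dx_flatten hG
  have h := sqrt_weighted_energy_le (H₀ := flatten G) (H₁ := dx (flatten G))
    (H₂ := dx (dx (flatten G))) (H₃ := dx (dx (dx (flatten G))))
    (decay 0) (decay 1) (decay 2) (decay 3)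
    (fun s hs => hasDerivAt_bdry hs) continuousOn_bdrySpeed
    (fun s hs => by unfold bdrySpeed; positivity)
    (fun x hx s hs => hasDerivAt_dx smooth₀ hx hs)
    (fun x hx s hs => hasDerivAt_dx smooth₁ hx hs)
    (fun x hx s hs => hasDerivAt_dx smooth₂ hx hs)
    (fun x hx s hs => (hasDerivAt_dt smooth₀ hx.le hs).congr_deriv (dt_flatten hG hx hs))
    (fun x hx s hs => hasDerivAt_time_dx_flatten hG hx hs)
    (fun s hs => flatten_zero hG hs) (fun s hs => flatten_boundary_relation hG hs) hτ hτ₁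
  rw [trNormW_eq, trNormW_eq, trNorm_pdX_eq hG (hτ.trans_le hτ₁)]
  refine h.trans ?_
  rw [mul_comm τ₁]
  gcongr
  linarith

end Flattening

/-- for 0 < τ < τ₁, ‖η G(·,τ)‖(τ) ≤ ‖η G(·,τ₁)‖(τ₁) + τ₁ ‖∂_η G(·,τ₁)‖(τ₁);
in particular sup over 0 < τ < τ₁ of ‖η G(·,τ)‖(τ) is finite. -/
theorem statement5 (G : ℝ → ℝ → ℂ) (hG : IsAdmissibleTr G) (τ₁ : ℝ) (hτ₁ : 0 < τ₁) :
    (∀ τ : ℝ, 0 < τ → τ < τ₁ →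
      trNormW G τ ≤ trNormW G τ₁ + τ₁ * trNorm (pdX G) τ₁) ∧
    BddAbove ((fun τ => trNormW G τ) '' Set.Ioo 0 τ₁) := by
  have h := fun τ (hτ : 0 < τ) (hlt : τ < τ₁) => trNormW_le hG hτ hlt.le
  refine ⟨h, trNormW G τ₁ + τ₁ * trNorm (pdX G) τ₁, ?_⟩
  rintro _ ⟨τ, hτ, rfl⟩
  exact h τ hτ.1 hτ.2
end
end

section
/- Let Λ > 0, let G₀ ∈ C₀^∞(ℝ) with support contained in [−Λ,Λ], let the functions G_m be defined recursively by G_{m+1}(η) = −(i/(2m+2)) G_m″(η) for m ≥ 0, and for N ∈ ℕ and t > 0 define ψ^(N)(x,t) = t^{−1/2} exp{ i(7/120)t⁵ + (i/2)η t³ + (i/2)η² t } · Σ_{m=0}^{N} t^{−m} G_m(η), where η = x/t − t²/6. Let L denote the operator Lψ = i ∂ψ/∂t + (1/2) ∂²ψ/∂x² + x t ψ. Then there exists a constant C_N (depending on N and G₀ but not on t) such that for all t > (6Λ)^{1/2} + 1, ‖(L ψ^(N))(·,t)‖_{L²(0,+∞)} ≤ C_N · t^{−2−N}. -/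
open MeasureTheory Filter Set Function

noncomputable section

/-- The Schrödinger-type operator L ψ = i ψ_t + (1/2) ψ_xx + x t ψ. -/
def Lop (f : ℝ → ℝ → ℂ) : ℝ → ℝ → ℂ :=
  fun x t => Complex.I * pdT f x t + (1/2) * pdX (pdX f) x t + (x:ℂ) * (t:ℂ) * f x t

/-- The truncated searchlight asymptotic solution
ψ^(N)(x,t) = t^{-1/2} exp{i(7/120)t⁵ + (i/2)η t³ + (i/2)η² t} Σ_{m=0}^{N} t^{-m} G_m(η),
with η = x/t − t²/6. -/
def psiN (Gm : ℕ → ℝ → ℂ) (N : ℕ) (x t : ℝ) : ℂ :=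
  (((Real.sqrt t)⁻¹ : ℝ) : ℂ) *
    Complex.exp (Complex.I * ((7/120) * (t:ℂ)^5
      + ((x/t - t^2/6 : ℝ) : ℂ) * (t:ℂ)^3 / 2
      + ((x/t - t^2/6 : ℝ) : ℂ)^2 * (t:ℂ) / 2)) *
    ∑ m ∈ Finset.range (N+1), ((t:ℂ)^m)⁻¹ * Gm m (x/t - t^2/6)

/-- The phase factor of the searchlight asymptotics, as a function of `η` and `t`. -/
def searchlightPhase (η t : ℝ) : ℂ :=
  Complex.exp (Complex.I * ((7/120) * (t:ℂ)^5 + (η:ℂ) * (t:ℂ)^3 / 2 + (η:ℂ)^2 * (t:ℂ) / 2))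

lemma norm_searchlightPhase (η t : ℝ) : ‖searchlightPhase η t‖ = 1 := by
  have := Complex.norm_exp_I_mul_ofReal ((7/120) * t^5 + η * t^3 / 2 + η^2 * t / 2)
  push_cast at this
  exact this

lemma hasDerivAt_searchlightPhase_left (η t : ℝ) :
    HasDerivAt (fun y => searchlightPhase y t)
      (searchlightPhase η t * (Complex.I * ((t:ℂ)^3 / 2 + η * t))) η := by
  have h : HasDerivAt (fun y : ℝ => (y:ℂ)) 1 η := Complex.ofRealCLM.hasDerivAt
  have := ((((h.mul_const ((t:ℂ)^3)).div_const 2).const_add ((7/120) * (t:ℂ)^5)).add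
    (((h.pow 2).mul_const (t:ℂ)).div_const 2)).const_mul Complex.I |>.cexp
  refine this.congr_deriv ?_
  simp [searchlightPhase]
  ring

lemma hasDerivAt_searchlightPhase_mul {F : ℝ → ℂ} {F' : ℂ} {x t : ℝ} (c : ℂ) (ht : t ≠ 0)
    (hF : HasDerivAt F F' (x/t - t^2/6)) :
    HasDerivAt (fun y => c * searchlightPhase (y/t - t^2/6) t * F (y/t - t^2/6))
      (c * searchlightPhase (x/t - t^2/6) t *
        (Complex.I * ((t:ℂ)^2 / 2 + (x/t - t^2/6 : ℝ)) * F (x/t - t^2/6) + F' / t)) x := by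
  have hη : HasDerivAt (fun y : ℝ => y/t - t^2/6) (1/t) x :=
    ((hasDerivAt_id x).div_const t).sub_const _
  have h := (((hasDerivAt_searchlightPhase_left (x/t - t^2/6) t).scomp x hη).const_mul c).mul
    (hF.scomp x hη)
  refine h.congr_deriv ?_
  have htc : (t:ℂ) ≠ 0 := by exact_mod_cast ht
  simp only [Complex.real_smul, Function.comp_apply]
  push_cast
  field_simp

lemma hasDerivAt_searchlightPhase_comp {x t : ℝ} (ht : t ≠ 0) :
    HasDerivAt (fun s => searchlightPhase (x/s - s^2/6) s)
      (searchlightPhase (x/t - t^2/6) t * (Complex.I * ((7/24) * (t:ℂ)^4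
        + (3/2) * (x/t - t^2/6 : ℝ) * (t:ℂ)^2 + ((x/t - t^2/6 : ℝ):ℂ)^2 / 2
        - ((x/t - t^2/6 : ℝ) + (t:ℂ)^2 / 2)^2))) t := by
  have htc : (t:ℂ) ≠ 0 := by exact_mod_cast ht
  have h : HasDerivAt (fun y : ℝ => (y:ℂ)) 1 t := Complex.ofRealCLM.hasDerivAt
  have hη : HasDerivAt (fun s : ℝ => ((x/s - s^2/6 : ℝ) : ℂ)) (-x/t^2 - t/3) t := by
    have h0 := ((h.inv htc).const_mul (x:ℂ)).sub ((h.pow 2).div_const 6)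
    refine (h0.congr_deriv ?_).congr_of_eventuallyEq (Eventually.of_forall fun s => ?_)
    · simp
      ring
    · simp [div_eq_mul_inv]
  have := ((((h.pow 5).const_mul (7/120:ℂ)).add ((hη.mul (h.pow 3)).div_const 2)).add
    (((hη.pow 2).mul h).div_const 2)).const_mul Complex.I |>.cexp
  refine this.congr_deriv ?_
  simp [searchlightPhase]
  field_simp
  ring

lemma hasDerivAt_inv_sqrt_ofReal {t : ℝ} (ht : 0 < t) :
    HasDerivAt (fun s : ℝ => (((Real.sqrt s)⁻¹ : ℝ) : ℂ))
      (-(((Real.sqrt t)⁻¹ : ℝ) : ℂ) / (2 * t)) t := by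
  have h := ((Real.hasDerivAt_sqrt ht.ne').inv (Real.sqrt_pos.2 ht).ne').ofReal_comp
  refine h.congr_deriv ?_
  rw [Real.sq_sqrt ht.le]
  push_cast
  have : (Real.sqrt t : ℂ) ≠ 0 := by exact_mod_cast (Real.sqrt_pos.2 ht).ne'
  field_simp

lemma psiN_eq (Gm : ℕ → ℝ → ℂ) (N : ℕ) (x t : ℝ) :
    psiN Gm N x t = (((Real.sqrt t)⁻¹ : ℝ) : ℂ) * searchlightPhase (x/t - t^2/6) t *
      ∑ m ∈ Finset.range (N+1), ((t:ℂ)^m)⁻¹ * Gm m (x/t - t^2/6) := rfl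

/-- The transport recursion makes the sum telescope. -/
lemma sum_transport_recursion (g g'' : ℕ → ℂ) (t : ℂ)
    (hrec : ∀ m : ℕ, g (m+1) = -(Complex.I / (2*(m:ℂ)+2)) * g'' m) (N : ℕ) :
    Complex.I * ∑ m ∈ Finset.range (N+1), -(m:ℂ) * (t^(m+1))⁻¹ * g m
      + 1 / (2 * t^2) * ∑ m ∈ Finset.range (N+1), (t^m)⁻¹ * g'' m
      = (t^(N+2))⁻¹ / 2 * g'' N := by
  induction N with
  | zero => simp only [zero_add, Finset.sum_range_one]; simp; ring_nf; simp
  | succ N ih =>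
    rw [Finset.sum_range_succ _ (N+1), Finset.sum_range_succ _ (N+1), mul_add, mul_add,
      add_add_add_comm, ih, hrec N]
    have hN : (N:ℂ) + 1 ≠ 0 := Nat.cast_add_one_ne_zero N
    have hN' : (2 * (N:ℂ) + 2) ≠ 0 := by
      rw [show 2 * (N:ℂ) + 2 = 2 * (N + 1) by ring]
      exact mul_ne_zero two_ne_zero hN
    have hcoef : Complex.I * (-((N:ℂ) + 1) * (-(Complex.I / (2*(N:ℂ)+2)))) = -(1/2) := by
      field_simp
      rw [Complex.I_sq]
    have : Complex.I * (-((N + 1 : ℕ):ℂ) * (t^(N+1+1))⁻¹ * (-(Complex.I / (2*(N:ℂ)+2)) * g'' N))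
        = -(1/2) * ((t^(N+2))⁻¹ * g'' N) := by
      push_cast
      linear_combination ((t^(N+2))⁻¹ * g'' N) * hcoef
    rw [this]
    have e : 1 / (2 * t^2) * ((t^(N+1))⁻¹ * g'' (N+1)) = (t^(N+1+2))⁻¹ / 2 * g'' (N+1) := by
      rw [pow_add t (N+1) 2, mul_inv]
      ring
    rw [e]
    ring

lemma pdT_psiN {Gm : ℕ → ℝ → ℂ} (hG : ∀ m, Differentiable ℝ (Gm m)) (N : ℕ) (x : ℝ) {t : ℝ}
    (ht : 0 < t) :
    pdT (psiN Gm N) x t = (((Real.sqrt t)⁻¹ : ℝ) : ℂ) * searchlightPhase (x/t - t^2/6) t *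
      ((-1 / (2 * t) + Complex.I * ((7/24) * (t:ℂ)^4
        + (3/2) * (x/t - t^2/6 : ℝ) * (t:ℂ)^2 + ((x/t - t^2/6 : ℝ):ℂ)^2 / 2
        - ((x/t - t^2/6 : ℝ) + (t:ℂ)^2 / 2)^2)) *
          ∑ m ∈ Finset.range (N+1), ((t:ℂ)^m)⁻¹ * Gm m (x/t - t^2/6)
        + ∑ m ∈ Finset.range (N+1), -(m:ℂ) * ((t:ℂ)^(m+1))⁻¹ * Gm m (x/t - t^2/6)
        - ((x/t - t^2/6 : ℝ) / t + (t:ℂ) / 2) *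
          ∑ m ∈ Finset.range (N+1), ((t:ℂ)^m)⁻¹ * deriv (Gm m) (x/t - t^2/6)) := by
  have htc : (t:ℂ) ≠ 0 := by exact_mod_cast ht.ne'
  have h : HasDerivAt (fun y : ℝ => (y:ℂ)) 1 t := Complex.ofRealCLM.hasDerivAt
  have hη : HasDerivAt (fun s : ℝ => x/s - s^2/6) (-((x/t - t^2/6) / t + t / 2)) t := by
    have h0 := ((hasDerivAt_inv ht.ne').const_mul x).sub (((hasDerivAt_id t).pow 2).div_const 6)
    refine (h0.congr_deriv ?_).congr_of_eventuallyEq (Eventually.of_forall fun s => ?_)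
    · have := ht.ne'
      simp
      field_simp
      ring
    · simp [div_eq_mul_inv]
  have hterm : ∀ m ∈ Finset.range (N+1),
      HasDerivAt (fun s : ℝ => ((s:ℂ)^m)⁻¹ * Gm m (x/s - s^2/6))
        (-(m:ℂ) * ((t:ℂ)^(m+1))⁻¹ * Gm m (x/t - t^2/6)
          - ((x/t - t^2/6 : ℝ) / t + (t:ℂ) / 2) *
            (((t:ℂ)^m)⁻¹ * deriv (Gm m) (x/t - t^2/6))) t := by
    intro m _
    have h1 := ((h.pow m).inv (pow_ne_zero m htc)).mul
      ((hG m (x/t - t^2/6)).hasDerivAt.scomp t hη)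
    refine h1.congr_deriv ?_
    have e : -((m:ℂ) * (t:ℂ)^(m-1)) / ((t:ℂ)^m)^2 = -(m:ℂ) * ((t:ℂ)^(m+1))⁻¹ := by
      cases m with
      | zero => simp
      | succ k =>
        simp only [Nat.add_sub_cancel]
        field_simp
        ring
    simp only [Complex.real_smul, Function.comp_apply, Pi.pow_apply, Pi.inv_apply, mul_one, e]
    push_cast
    ring
  have hS := HasDerivAt.fun_sum hterm
  have key := ((hasDerivAt_inv_sqrt_ofReal ht).mul
    (hasDerivAt_searchlightPhase_comp (x := x) ht.ne')).mul hS
  refine (key.congr_deriv ?_).deriv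
  rw [Finset.sum_sub_distrib, ← Finset.mul_sum]
  simp only [Pi.mul_apply]
  ring

lemma pdX_pdX_psiN {Gm : ℕ → ℝ → ℂ} (hG : ∀ m, Differentiable ℝ (Gm m))
    (hG' : ∀ m, Differentiable ℝ (deriv (Gm m))) (N : ℕ) (x : ℝ) {t : ℝ} (ht : 0 < t) :
    pdX (pdX (psiN Gm N)) x t =
      (((Real.sqrt t)⁻¹ : ℝ) : ℂ) * searchlightPhase (x/t - t^2/6) t *
      ((Complex.I / t - ((t:ℂ)^2 / 2 + (x/t - t^2/6 : ℝ))^2) *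
          ∑ m ∈ Finset.range (N+1), ((t:ℂ)^m)⁻¹ * Gm m (x/t - t^2/6)
        + 2 * Complex.I * ((t:ℂ) / 2 + (x/t - t^2/6 : ℝ) / t) *
          ∑ m ∈ Finset.range (N+1), ((t:ℂ)^m)⁻¹ * deriv (Gm m) (x/t - t^2/6)
        + 1 / (t:ℂ)^2 *
          ∑ m ∈ Finset.range (N+1), ((t:ℂ)^m)⁻¹ * deriv (deriv (Gm m)) (x/t - t^2/6)) := by
  have htc : (t:ℂ) ≠ 0 := by exact_mod_cast ht.ne'
  have hS : ∀ η, HasDerivAt (fun η => ∑ m ∈ Finset.range (N+1), ((t:ℂ)^m)⁻¹ * Gm m η)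
      (∑ m ∈ Finset.range (N+1), ((t:ℂ)^m)⁻¹ * deriv (Gm m) η) η := fun η =>
    HasDerivAt.fun_sum fun m _ => (hG m η).hasDerivAt.const_mul _
  have hS' : ∀ η, HasDerivAt (fun η => ∑ m ∈ Finset.range (N+1), ((t:ℂ)^m)⁻¹ * deriv (Gm m) η)
      (∑ m ∈ Finset.range (N+1), ((t:ℂ)^m)⁻¹ * deriv (deriv (Gm m)) η) η := fun η =>
    HasDerivAt.fun_sum fun m _ => (hG' m η).hasDerivAt.const_mul _
  have h1 : (fun y => pdX (psiN Gm N) y t) = fun y => _ := funext fun y =>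
    (hasDerivAt_searchlightPhase_mul (((Real.sqrt t)⁻¹ : ℝ) : ℂ) ht.ne' (hS (y/t - t^2/6))).deriv
  have hη : HasDerivAt (fun y : ℝ => (y:ℂ)) 1 (x/t - t^2/6) := Complex.ofRealCLM.hasDerivAt
  have h2 := hasDerivAt_searchlightPhase_mul (((Real.sqrt t)⁻¹ : ℝ) : ℂ) ht.ne'
    ((((hη.const_add ((t:ℂ)^2 / 2)).const_mul Complex.I).mul (hS (x/t - t^2/6))).add
      ((hS' (x/t - t^2/6)).div_const (t:ℂ)))
  unfold pdX at h1 ⊢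
  rw [h1]
  refine (h2.congr_deriv ?_).deriv
  simp only [Pi.add_apply, Pi.mul_apply]
  generalize (∑ m ∈ Finset.range (N+1), ((t:ℂ)^m)⁻¹ * Gm m (x/t - t^2/6)) = S
  generalize (∑ m ∈ Finset.range (N+1), ((t:ℂ)^m)⁻¹ * deriv (Gm m) (x/t - t^2/6)) = S'
  generalize (∑ m ∈ Finset.range (N+1),
    ((t:ℂ)^m)⁻¹ * deriv (deriv (Gm m)) (x/t - t^2/6)) = S''
  generalize (((x/t - t^2/6 : ℝ)) : ℂ) = η
  congr 1
  field_simp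
  ring_nf
  simp only [Complex.I_sq]
  ring

/-- Applying `L` to the truncated expansion leaves only the last second derivative. -/
lemma Lop_psiN {Gm : ℕ → ℝ → ℂ} (hG : ∀ m, Differentiable ℝ (Gm m))
    (hG' : ∀ m, Differentiable ℝ (deriv (Gm m)))
    (hrec : ∀ (m : ℕ) (η : ℝ),
      Gm (m+1) η = -(Complex.I / (2*(m:ℂ)+2)) * deriv (deriv (Gm m)) η)
    (N : ℕ) (x : ℝ) {t : ℝ} (ht : 0 < t) :
    Lop (psiN Gm N) x t = (((Real.sqrt t)⁻¹ : ℝ) : ℂ) * searchlightPhase (x/t - t^2/6) t *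
      (((t:ℂ)^(N+2))⁻¹ / 2 * deriv (deriv (Gm N)) (x/t - t^2/6)) := by
  have htc : (t:ℂ) ≠ 0 := by exact_mod_cast ht.ne'
  have hx : (x:ℂ) = t * (x/t - t^2/6 : ℝ) + (t:ℂ)^3 / 6 := by
    push_cast
    field_simp
    ring
  rw [Lop, pdT_psiN hG N x ht, pdX_pdX_psiN hG hG' N x ht, psiN_eq]
  rw [← sum_transport_recursion (fun m => Gm m (x/t - t^2/6))
    (fun m => deriv (deriv (Gm m)) (x/t - t^2/6)) (t:ℂ) (fun m => hrec m _) N]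
  generalize x/t - t^2/6 = η at hx ⊢
  rw [hx]
  generalize (∑ m ∈ Finset.range (N+1), ((t:ℂ)^m)⁻¹ * Gm m η) = S
  generalize (∑ m ∈ Finset.range (N+1), ((t:ℂ)^m)⁻¹ * deriv (Gm m) η) = S'
  generalize (∑ m ∈ Finset.range (N+1), ((t:ℂ)^m)⁻¹ * deriv (deriv (Gm m)) η) = S''
  generalize (∑ m ∈ Finset.range (N+1), -(m:ℂ) * ((t:ℂ)^(m+1))⁻¹ * Gm m η) = T
  generalize (((Real.sqrt t)⁻¹ : ℝ) : ℂ) * searchlightPhase η t = E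
  field_simp
  ring_nf
  simp only [Complex.I_sq]
  ring

lemma contDiff_and_hasCompactSupport_of_transport_recursion {Gm : ℕ → ℝ → ℂ}
    (hsm : ContDiff ℝ (⊤ : ℕ∞) (Gm 0)) (hcs : HasCompactSupport (Gm 0))
    (hrec : ∀ (m : ℕ) (η : ℝ),
      Gm (m+1) η = -(Complex.I / (2*(m:ℂ)+2)) * deriv (deriv (Gm m)) η) (m : ℕ) :
    ContDiff ℝ (⊤ : ℕ∞) (Gm m) ∧ HasCompactSupport (Gm m) := by
  induction m with
  | zero => exact ⟨hsm, hcs⟩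
  | succ m ih =>
    rw [funext (hrec m)]
    have h1 := (contDiff_infty_iff_deriv.1 ih.1).2
    have h2 := (contDiff_infty_iff_deriv.1 h1).2
    exact ⟨contDiff_const.mul h2, ih.2.deriv.deriv.mul_left⟩

lemma integrable_norm_sq_of_hasCompactSupport {g : ℝ → ℂ} (hg : Continuous g)
    (hs : HasCompactSupport g) : Integrable fun η => ‖g η‖^2 := by
  have hs2 : HasCompactSupport fun η => ‖g η‖ * ‖g η‖ := hs.norm.mul_left
  simp only [pow_two]
  exact (hg.norm.mul hg.norm).integrable_of_hasCompactSupport hs2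

lemma norm_Lop_psiN_sq {Gm : ℕ → ℝ → ℂ} (hG : ∀ m, Differentiable ℝ (Gm m))
    (hG' : ∀ m, Differentiable ℝ (deriv (Gm m)))
    (hrec : ∀ (m : ℕ) (η : ℝ),
      Gm (m+1) η = -(Complex.I / (2*(m:ℂ)+2)) * deriv (deriv (Gm m)) η)
    (N : ℕ) (x : ℝ) {t : ℝ} (ht : 0 < t) :
    ‖Lop (psiN Gm N) x t‖^2 =
      t⁻¹ * ((t^(N+2))⁻¹ / 2)^2 * ‖deriv (deriv (Gm N)) (x/t - t^2/6)‖^2 := by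
  rw [Lop_psiN hG hG' hrec N x ht]
  simp only [norm_mul, norm_div, norm_inv, norm_pow, Complex.norm_real, norm_searchlightPhase,
    Real.norm_eq_abs, abs_of_pos ht, mul_pow, inv_pow, sq_abs, Real.sq_sqrt ht.le,
    Complex.norm_ofNat, mul_one]
  ring

lemma L2R_eq_of_norm_sq_eq {f g : ℝ → ℂ} {a b t : ℝ} (ha : 0 ≤ a) (ht : 0 < t)
    (h : ∀ x, ‖f x‖^2 = t⁻¹ * a^2 * ‖g (x/t - b)‖^2) : L2R f = a * L2R g := by
  have hint : ∫ x, ‖g (x/t - b)‖^2 = t * ∫ η, ‖g η‖^2 := by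
    rw [Measure.integral_comp_div (fun y => ‖g (y - b)‖^2) t,
      integral_sub_right_eq_self (fun y => ‖g y‖^2), abs_of_pos ht, smul_eq_mul]
  simp only [L2R, h]
  rw [integral_const_mul, hint, show t⁻¹ * a^2 * (t * ∫ η, ‖g η‖^2) = a^2 * ∫ η, ‖g η‖^2 by
    field_simp, Real.sqrt_mul (sq_nonneg _), Real.sqrt_sq ha]

lemma L2h_le_L2R {f : ℝ → ℂ} (hf : Integrable fun x => ‖f x‖^2) : L2h f ≤ L2R f :=
  Real.sqrt_le_sqrt (setIntegral_le_integral hf (Eventually.of_forall fun _ => by positivity))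

/-- if G₀ ∈ C₀^∞(ℝ) is supported in [−Λ,Λ] and
G_{m+1} = −(i/(2m+2)) G_m'', then for every N there is a constant C_N with
‖(L ψ^(N))(·,t)‖_{L²(0,∞)} ≤ C_N t^{−2−N} for all t > (6Λ)^{1/2} + 1. -/
theorem statement18 (Λ : ℝ) (hΛ : 0 < Λ) (Gm : ℕ → ℝ → ℂ)
    (hsm : ContDiff ℝ (⊤ : ℕ∞) (Gm 0)) (hcs : HasCompactSupport (Gm 0))
    (hsupp : tsupport (Gm 0) ⊆ Set.Icc (-Λ) Λ)
    (hrec : ∀ (m : ℕ) (η : ℝ),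
      Gm (m+1) η = -(Complex.I / (2*(m:ℂ)+2)) * deriv (deriv (Gm m)) η)
    (N : ℕ) :
    ∃ C : ℝ, ∀ t : ℝ, Real.sqrt (6*Λ) + 1 < t →
      L2h (fun x => Lop (psiN Gm N) x t) ≤ C * t ^ (-(2:ℝ) - N) := by
  have hreg := contDiff_and_hasCompactSupport_of_transport_recursion hsm hcs hrec
  have hd1 : ∀ m, ContDiff ℝ (⊤ : ℕ∞) (deriv (Gm m)) := fun m =>
    (contDiff_infty_iff_deriv.1 (hreg m).1).2
  refine ⟨L2R (deriv (deriv (Gm N))) / 2, fun t ht => ?_⟩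
  have ht0 : 0 < t := lt_of_le_of_lt (by positivity) ht
  have hnorm := fun x => norm_Lop_psiN_sq (fun m => (contDiff_infty_iff_deriv.1 (hreg m).1).1)
    (fun m => (contDiff_infty_iff_deriv.1 (hd1 m)).1) hrec N x ht0
  have hi : Integrable fun x => ‖Lop (psiN Gm N) x t‖^2 := by
    simp only [hnorm]
    exact (((integrable_norm_sq_of_hasCompactSupport
      (contDiff_infty_iff_deriv.1 (hd1 N)).2.continuous
      (hreg N).2.deriv.deriv).comp_sub_right (t^2/6)).comp_div ht0.ne').const_mul _
  have hpow : t ^ (-(2:ℝ) - N) = (t^(N+2))⁻¹ := by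
    rw [← Real.rpow_natCast, ← Real.rpow_neg ht0.le]
    push_cast
    ring_nf
  refine (L2h_le_L2R hi).trans (le_of_eq ?_)
  rw [hpow, L2R_eq_of_norm_sq_eq (by positivity) ht0 hnorm]
  ring
end
end
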